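/- For every β ∈ (0,1) and every γ > 0 there exist c > 0 and n₀ such that the following holds. Let n ≥ n₀ with n ≡ 3 (mod 6), let δ > 0 satisfy δ·log n ≤ c, and let S be an order-n Steiner triple system on vertex set V = {1,…,n} satisfying: (1) there is an absorbing structure H in S with flexible set Z of size 6⌊δ²n⌋ (i.e., with template parameter t = 3⌊δ²n⌋); (2) for at most δn of the vertices v ∈ V ∖ V(H) one has |{ {x,y} ⊆ Z : {v,x,y} ∈ S }| < 6δ⁵n; (3) every subset W ⊆ V with |W| ≥ 3δ⁵n contains at least (1−β)·|W|³/(6n) hyperedges of S. Then S has at least ((1 − β − γ)·n/(2e²))^{n/3} perfect matchings. -/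

import Mathlib

open scoped Classical

noncomputable section

/-- `S` is an order-`n` Steiner triple system on vertex set `Fin n`. -/
def IsSTS (n : ℕ) (S : Finset (Finset (Fin n))) : Prop :=
  (∀ e ∈ S, e.card = 3) ∧
  ∀ p : Finset (Fin n), p.card = 2 → ∃! e, e ∈ S ∧ p ⊆ e

/-- `M` is a matching of the 3-uniform hypergraph `S`. -/
def IsMatching (n : ℕ) (S M : Finset (Finset (Fin n))) : Prop :=
  M ⊆ S ∧ ∀ e ∈ M, ∀ f ∈ M, e ≠ f → Disjoint e f

/-- The number of perfect matchings (matchings with `n/3` hyperedges) of `S`. -/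
def numPM (n : ℕ) (S : Finset (Finset (Fin n))) : ℕ :=
  (Finset.univ.filter (fun M : Finset (Finset (Fin n)) =>
    IsMatching n S M ∧ M.card = n / 3)).card

/-- An absorber for `(x,y,z)` in `S` with external vertex set `ext`: twelve distinct
vertices carrying the seven prescribed hyperedges of `S`. -/
def IsAbsorber {n : ℕ} (S : Finset (Finset (Fin n))) (x y z : Fin n)
    (ext : Finset (Fin n)) : Prop :=
  ∃ x₁ x₂ y₁ y₂ z₁ z₂ wx wy wz : Fin n,
    ext = {x₁, x₂, y₁, y₂, z₁, z₂, wx, wy, wz} ∧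
    (({x, y, z} : Finset (Fin n)) ∪ ext).card = 12 ∧
    ({x, x₁, x₂} : Finset (Fin n)) ∈ S ∧ ({y, y₁, y₂} : Finset (Fin n)) ∈ S ∧
    ({z, z₁, z₂} : Finset (Fin n)) ∈ S ∧ ({wx, wy, wz} : Finset (Fin n)) ∈ S ∧
    ({x₁, y₂, wz} : Finset (Fin n)) ∈ S ∧ ({y₁, z₂, wx} : Finset (Fin n)) ∈ S ∧
    ({z₁, x₂, wy} : Finset (Fin n)) ∈ S

/-- An absorbing structure in `S` with template parameter `t`, flexible set `Z` and
vertex set `VH`: a resilient template `T` on `10t` vertices with `120t` hyperedges and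
flexible set `Z` of size `2t`, together with externally vertex-disjoint absorbers of
`S` rooted on the hyperedges of `T`. -/
def IsAbsorbingStructure {n : ℕ} (S : Finset (Finset (Fin n))) (t : ℕ)
    (Z VH : Finset (Fin n)) : Prop :=
  ∃ (VT : Finset (Fin n)) (E : Finset (Finset (Fin n)))
    (ext : Finset (Fin n) → Finset (Fin n)),
    VT.card = 10 * t ∧ E.card = 120 * t ∧ (∀ e ∈ E, e.card = 3 ∧ e ⊆ VT) ∧
    Z ⊆ VT ∧ Z.card = 2 * t ∧
    -- resilience of the template
    (∀ Z' ⊆ Z, Z'.card = t →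
      ∃ M ⊆ E, (∀ e ∈ M, ∀ v ∈ e, v ∉ Z') ∧
        (∀ e ∈ M, ∀ f ∈ M, e ≠ f → Disjoint e f) ∧
        (∀ v ∈ VT, v ∉ Z' → ∃ e ∈ M, v ∈ e)) ∧
    -- absorbers on the template hyperedges, with external vertices outside `VT`
    (∀ e ∈ E, ∃ x y z : Fin n, e = {x, y, z} ∧ IsAbsorber S x y z (ext e) ∧
      Disjoint (ext e) VT) ∧
    -- the external vertex sets are pairwise disjoint
    (∀ e ∈ E, ∀ f ∈ E, e ≠ f → Disjoint (ext e) (ext f)) ∧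
    VH = VT ∪ E.biUnion ext

/-- The number of pairs `{x,y} ⊆ Z` with `{v,x,y}` a hyperedge of `S`. -/
def pairDeg {n : ℕ} (S : Finset (Finset (Fin n))) (Z : Finset (Fin n))
    (v : Fin n) : ℕ :=
  ((Z.powersetCard 2).filter (fun p => insert v p ∈ S)).card

/-- `M` is a set of disjoint hyperedges of `S` covering exactly `A`. -/
def PMon {n : ℕ} (S : Finset (Finset (Fin n))) (A : Finset (Fin n))
    (M : Finset (Finset (Fin n))) : Prop :=
  IsMatching n S M ∧ M.biUnion id = A

theorem PMon.empty {n : ℕ} (S : Finset (Finset (Fin n))) : PMon S ∅ ∅ := by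
  simp [PMon, IsMatching]

theorem PMon.single {n : ℕ} {S : Finset (Finset (Fin n))} {e : Finset (Fin n)} (he : e ∈ S) :
    PMon S e {e} := by
  refine ⟨⟨by simpa using he, ?_⟩, by simp⟩
  intro a ha b hb hab
  simp only [Finset.mem_singleton] at ha hb
  exact absurd (ha.trans hb.symm) hab

theorem PMon.subset {n : ℕ} {S M : Finset (Finset (Fin n))} {A : Finset (Fin n)}
    (h : PMon S A M) {e : Finset (Fin n)} (he : e ∈ M) : e ⊆ A := by
  rw [← h.2]
  exact Finset.subset_biUnion_of_mem id he

theorem PMon.biUnion {n : ℕ} {S : Finset (Finset (Fin n))} {ι : Type*} (I : Finset ι)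
    (A : ι → Finset (Fin n)) (M : ι → Finset (Finset (Fin n)))
    (h : ∀ i ∈ I, PMon S (A i) (M i))
    (hd : ∀ i ∈ I, ∀ j ∈ I, i ≠ j → Disjoint (A i) (A j)) :
    PMon S (I.biUnion A) (I.biUnion M) := by
  refine ⟨⟨?_, ?_⟩, ?_⟩
  · exact Finset.biUnion_subset.2 fun i hi => (h i hi).1.1
  · intro e he f hf hef
    obtain ⟨i, hi, hei⟩ := Finset.mem_biUnion.1 he
    obtain ⟨j, hj, hfj⟩ := Finset.mem_biUnion.1 hf
    by_cases hij : i = j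
    · subst hij
      exact (h i hi).1.2 e hei f hfj hef
    · exact (hd i hi j hj hij).mono ((h i hi).subset hei) ((h j hj).subset hfj)
  · rw [Finset.biUnion_biUnion]
    exact Finset.biUnion_congr rfl fun i hi => (h i hi).2

theorem PMon.union {n : ℕ} {S : Finset (Finset (Fin n))} {A B : Finset (Fin n)}
    {M N : Finset (Finset (Fin n))} (hA : PMon S A M) (hB : PMon S B N) (hd : Disjoint A B) :
    PMon S (A ∪ B) (M ∪ N) := by
  refine ⟨⟨Finset.union_subset hA.1.1 hB.1.1, ?_⟩, ?_⟩
  · intro e he f hf hef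
    rcases Finset.mem_union.1 he with he | he <;> rcases Finset.mem_union.1 hf with hf | hf
    · exact hA.1.2 e he f hf hef
    · exact hd.mono (hA.subset he) (hB.subset hf)
    · exact (hd.mono (hA.subset hf) (hB.subset he)).symm
    · exact hB.1.2 e he f hf hef
  · rw [Finset.union_biUnion, hA.2, hB.2]

theorem PMon.card {n : ℕ} {S : Finset (Finset (Fin n))} (hS : IsSTS n S) {A : Finset (Fin n)}
    {M : Finset (Finset (Fin n))} (h : PMon S A M) : A.card = 3 * M.card := by
  have h1 : (M.biUnion id).card = ∑ e ∈ M, (id e : Finset (Fin n)).card :=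
    Finset.card_biUnion (fun e he f hf hef => h.1.2 e he f hf hef)
  have h2 : ∑ e ∈ M, (id e : Finset (Fin n)).card = M.card * 3 :=
    Finset.sum_const_nat (fun e he => hS.1 e (h.1.1 he))
  rw [← h.2, h1, h2, mul_comm]

theorem sts_unique {n : ℕ} {S : Finset (Finset (Fin n))} (hS : IsSTS n S) {v w : Fin n}
    (hvw : v ≠ w) {e f : Finset (Fin n)} (he : e ∈ S) (hf : f ∈ S) (hve : v ∈ e) (hwe : w ∈ e)
    (hvf : v ∈ f) (hwf : w ∈ f) : e = f := by
  obtain ⟨g, -, hg⟩ := hS.2 {v, w} (Finset.card_pair hvw)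
  rw [hg e ⟨he, by simp [Finset.insert_subset_iff, hve, hwe]⟩,
    hg f ⟨hf, by simp [Finset.insert_subset_iff, hvf, hwf]⟩]

theorem sts_exists {n : ℕ} {S : Finset (Finset (Fin n))} (hS : IsSTS n S) {v w : Fin n}
    (hvw : v ≠ w) : ∃ e ∈ S, v ∈ e ∧ w ∈ e := by
  obtain ⟨g, hg, -⟩ := hS.2 {v, w} (Finset.card_pair hvw)
  exact ⟨g, hg.1, hg.2 (by simp), hg.2 (by simp)⟩

/-- An edge through `v` avoiding a smallish set. -/
theorem sts_avoid {n : ℕ} {S : Finset (Finset (Fin n))} (hS : IsSTS n S) (v : Fin n)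
    (F : Finset (Fin n)) (hv : v ∉ F) (hF : 3 * F.card + 1 < n) :
    ∃ e ∈ S, v ∈ e ∧ Disjoint e F := by
  have h1 : ∀ f : Fin n, ∃ e : Finset (Fin n), f ∈ F → e ∈ S ∧ v ∈ e ∧ f ∈ e := by
    intro f
    by_cases hf : f ∈ F
    · obtain ⟨e, he, h2⟩ := sts_exists hS (v := v) (w := f) (by rintro rfl; exact hv hf)
      exact ⟨e, fun _ => ⟨he, h2⟩⟩
    · exact ⟨∅, fun h => absurd h hf⟩
  choose g hg using h1
  have h2 : (insert v (F.biUnion g)).card < (Finset.univ : Finset (Fin n)).card := by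
    have := Finset.card_insert_le v (F.biUnion g)
    have h3 : (F.biUnion g).card ≤ F.card * 3 :=
      Finset.card_biUnion_le_card_mul _ _ _ fun f hf => (hS.1 _ (hg f hf).1).le
    rw [Finset.card_univ, Fintype.card_fin]
    omega
  obtain ⟨w, -, hw⟩ := Finset.exists_mem_notMem_of_card_lt_card h2
  simp only [Finset.mem_insert, not_or] at hw
  obtain ⟨e, he, hve, hwe⟩ := sts_exists hS (v := v) (w := w) (fun h => hw.1 h.symm)
  refine ⟨e, he, hve, ?_⟩
  rw [Finset.disjoint_left]
  intro f hfe hfF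
  apply hw.2
  have : e = g f := sts_unique hS (v := v) (w := f) (by rintro rfl; exact hv hfF) he (hg f hfF).1
    hve hfe (hg f hfF).2.1 (hg f hfF).2.2
  exact Finset.mem_biUnion.2 ⟨f, hfF, this ▸ hwe⟩

/-- Cover the bad vertices. -/
theorem cover_bad {n : ℕ} {S : Finset (Finset (Fin n))} (hS : IsSTS n S)
    (VH B : Finset (Fin n)) (hB : Disjoint B VH) (hc : 3 * (VH.card + 3 * B.card) + 1 < n) :
    ∃ A M, PMon S A M ∧ B ⊆ A ∧ Disjoint A VH ∧ M.card ≤ B.card := by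
  induction B using Finset.induction_on with
  | empty => exact ⟨∅, ∅, PMon.empty S, by simp⟩
  | insert v B hv ih =>
    rw [Finset.card_insert_of_notMem hv] at hc ⊢
    rw [Finset.disjoint_insert_left] at hB
    obtain ⟨A, M, hM, hBA, hA, hcM⟩ := ih hB.2 (by omega)
    by_cases hvA : v ∈ A
    · exact ⟨A, M, hM, Finset.insert_subset hvA hBA, hA, by omega⟩
    · have h1 := hM.card hS
      have h2 := Finset.card_union_le A VH
      obtain ⟨e, he, hve, hd⟩ := sts_avoid hS v (A ∪ VH) (by simp [hvA, hB.1]) (by omega)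
      rw [Finset.disjoint_union_right] at hd
      refine ⟨A ∪ e, M ∪ {e}, hM.union (PMon.single he) hd.1.symm, ?_, ?_, ?_⟩
      · exact Finset.insert_subset (by simp [hve]) (hBA.trans Finset.subset_union_left)
      · rw [Finset.disjoint_union_left]; exact ⟨hA, hd.2⟩
      · exact (Finset.card_union_le _ _).trans (by simpa using hcM)

/-- Match the remaining vertices into the flexible set. -/
theorem match_into {n : ℕ} {S : Finset (Finset (Fin n))} (hS : IsSTS n S)
    (Z R : Finset (Fin n)) (hd : Disjoint R Z) (hR : ∀ v ∈ R, 2 * R.card < pairDeg S Z v + 2) :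
    ∃ Z₁ M, Z₁ ⊆ Z ∧ Z₁.card = 2 * R.card ∧ PMon S (R ∪ Z₁) M := by
  induction R using Finset.induction_on with
  | empty => exact ⟨∅, ∅, by simp, by simp, by simpa using PMon.empty S⟩
  | insert v R hv ih =>
    rw [Finset.card_insert_of_notMem hv] at hR ⊢
    rw [Finset.disjoint_insert_left] at hd
    obtain ⟨Z₁, M, hZ, hZc, hM⟩ := ih hd.2
      (fun w hw => by have := hR w (Finset.mem_insert_of_mem hw); omega)
    have h1 := hR v (Finset.mem_insert_self v R)
    have h2 : ∃ p ∈ (Z.powersetCard 2).filter (fun p => insert v p ∈ S), Disjoint p Z₁ := by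
      by_contra! hcon
      have h3 : ∀ p : Finset (Fin n), ∃ x : Fin n,
          p ∈ (Z.powersetCard 2).filter (fun p => insert v p ∈ S) → x ∈ p ∧ x ∈ Z₁ := by
        intro p
        by_cases hp : p ∈ (Z.powersetCard 2).filter (fun p => insert v p ∈ S)
        · obtain ⟨x, hx⟩ := Finset.not_disjoint_iff.1 (hcon p hp)
          exact ⟨x, fun _ => hx⟩
        · exact ⟨v, fun h => absurd h hp⟩
      choose g hg using h3
      have h4 : Z₁.card < ((Z.powersetCard 2).filter (fun p => insert v p ∈ S)).card := by
        unfold pairDeg at h1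
        omega
      obtain ⟨p, hp, q, hq, hpq, hgpq⟩ := Finset.exists_ne_map_eq_of_card_lt_of_maps_to h4
        (f := g) (fun p hp => (hg p hp).2)
      apply hpq
      have hp' := Finset.mem_filter.1 hp
      have hq' := Finset.mem_filter.1 hq
      have hpZ := (Finset.mem_powersetCard.1 hp'.1).1
      have hqZ := (Finset.mem_powersetCard.1 hq'.1).1
      have hgp := (hg p hp).1
      have hgq := (hg q hq).1
      have hne : v ≠ g p := by
        intro h
        apply hd.1
        rw [h]
        exact hpZ hgp
      have := sts_unique hS hne hp'.2 hq'.2 (by simp) (by simp [hgp]) (by simp)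
        (by rw [hgpq]; simp [hgq])
      rw [← Finset.erase_insert (fun h => hd.1 (hpZ h)), this,
        Finset.erase_insert (fun h => hd.1 (hqZ h))]
    obtain ⟨p, hp, hpd⟩ := h2
    have hp' := Finset.mem_filter.1 hp
    obtain ⟨hpZ, hpc⟩ := Finset.mem_powersetCard.1 hp'.1
    refine ⟨Z₁ ∪ p, M ∪ {insert v p}, Finset.union_subset hZ hpZ, ?_, ?_⟩
    · rw [Finset.card_union_of_disjoint hpd.symm]; omega
    · have h5 : insert v R ∪ (Z₁ ∪ p) = (R ∪ Z₁) ∪ insert v p := by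
        ext a; simp only [Finset.mem_union, Finset.mem_insert]; tauto
      rw [h5]
      refine hM.union (PMon.single hp'.2) ?_
      rw [Finset.disjoint_insert_right, Finset.disjoint_union_left]
      refine ⟨?_, hd.2.mono_right hpZ, hpd.symm⟩
      simp only [Finset.mem_union, not_or]
      exact ⟨hv, fun h => hd.1 (hZ h)⟩

/-- Greedily take `q` edges. -/
theorem greedy_edges {n : ℕ} {S : Finset (Finset (Fin n))} (hS : IsSTS n S)
    (t : ℕ) (Y : Finset (Fin n)) (q : ℕ) (hY : t + 3 * q ≤ Y.card + 3)
    (hW : ∀ W : Finset (Fin n), t ≤ W.card → ∃ e ∈ S, e ⊆ W) :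
    ∃ A M, PMon S A M ∧ A ⊆ Y ∧ M.card = q := by
  induction q with
  | zero => exact ⟨∅, ∅, PMon.empty S, by simp⟩
  | succ q ih =>
    obtain ⟨A, M, hM, hA, hc⟩ := ih (by omega)
    have h1 := hM.card hS
    have h2 := Finset.card_sdiff_of_subset hA
    obtain ⟨e, he, heW⟩ := hW (Y \ A) (by omega)
    have hd : Disjoint A e := (Finset.disjoint_sdiff).mono_right heW
    have h3 := hM.union (PMon.single he) hd
    refine ⟨_, _, h3, Finset.union_subset hA (heW.trans Finset.sdiff_subset), ?_⟩
    have h4 := h3.card hS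
    rw [Finset.card_union_of_disjoint hd, hS.1 e he] at h4
    omega

theorem PMon.congr {n : ℕ} {S : Finset (Finset (Fin n))} {A B : Finset (Fin n)}
    {M : Finset (Finset (Fin n))} (h : PMon S A M) (hAB : A = B) : ∃ M, PMon S B M :=
  ⟨M, hAB ▸ h⟩

theorem PMon.union' {n : ℕ} {S : Finset (Finset (Fin n))} {A B : Finset (Fin n)}
    {M N : Finset (Finset (Fin n))} (hA : PMon S A M) (hB : PMon S B N)
    (hd : A.card + B.card ≤ (A ∪ B).card) :
    PMon S (A ∪ B) (M ∪ N) := by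
  refine hA.union hB ?_
  rw [← Finset.card_union_eq_card_add_card]
  exact le_antisymm (Finset.card_union_le _ _) hd

theorem absorber_matchings {n : ℕ} {S : Finset (Finset (Fin n))} (hS : IsSTS n S) {x y z : Fin n}
    {ext : Finset (Fin n)} (h : IsAbsorber S x y z ext) :
    (∃ M, PMon S ({x, y, z} ∪ ext) M) ∧ (∃ M, PMon S ext M) ∧ ext.card ≤ 9 := by
  obtain ⟨x₁, x₂, y₁, y₂, z₁, z₂, wx, wy, wz, rfl, hc, h1, h2, h3, h4, h5, h6, h7⟩ := h
  have c1 := hS.1 _ h1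
  have c2 := hS.1 _ h2
  have c3 := hS.1 _ h3
  have c4 := hS.1 _ h4
  have c5 := hS.1 _ h5
  have c6 := hS.1 _ h6
  have c7 := hS.1 _ h7
  have e1 : ({x, x₁, x₂} ∪ {y, y₁, y₂} ∪ {z, z₁, z₂} ∪ {wx, wy, wz} : Finset (Fin n)) =
      {x, y, z} ∪ {x₁, x₂, y₁, y₂, z₁, z₂, wx, wy, wz} := by
    ext a; simp only [Finset.mem_union, Finset.mem_insert, Finset.mem_singleton,
      or_comm, or_left_comm, or_assoc]
  have e2 : ({x₁, y₂, wz} ∪ {y₁, z₂, wx} ∪ {z₁, x₂, wy} : Finset (Fin n)) =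
      {x₁, x₂, y₁, y₂, z₁, z₂, wx, wy, wz} := by
    ext a; simp only [Finset.mem_union, Finset.mem_insert, Finset.mem_singleton,
      or_comm, or_left_comm, or_assoc]
  have c0 : ({x, y, z} : Finset (Fin n)).card ≤ 3 := Finset.card_le_three
  rw [← e2] at hc e1 ⊢
  rw [← e1] at hc ⊢
  have u1 := Finset.card_union_le ({x, x₁, x₂} ∪ {y, y₁, y₂} ∪ {z, z₁, z₂} : Finset (Fin n))
    {wx, wy, wz}
  have u2 := Finset.card_union_le ({x, x₁, x₂} ∪ {y, y₁, y₂} : Finset (Fin n)) {z, z₁, z₂}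
  have u3 := Finset.card_union_le ({x, x₁, x₂} : Finset (Fin n)) {y, y₁, y₂}
  have v1 := Finset.card_union_le ({x₁, y₂, wz} ∪ {y₁, z₂, wx} : Finset (Fin n)) {z₁, x₂, wy}
  have v2 := Finset.card_union_le ({x₁, y₂, wz} : Finset (Fin n)) {y₁, z₂, wx}
  have v3 := Finset.card_union_le ({x, y, z} : Finset (Fin n))
    ({x₁, y₂, wz} ∪ {y₁, z₂, wx} ∪ {z₁, x₂, wy})
  rw [← e1] at v3
  refine ⟨?_, ?_, ?_⟩
  · have k1 := (PMon.single h1).union' (PMon.single h2) (by omega)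
    have k2 := k1.union' (PMon.single h3) (by omega)
    exact ⟨_, k2.union' (PMon.single h4) (by omega)⟩
  · have k1 := (PMon.single h5).union' (PMon.single h6) (by omega)
    exact ⟨_, k1.union' (PMon.single h7) (by omega)⟩
  · omega

theorem absorbing {n : ℕ} {S : Finset (Finset (Fin n))} (hS : IsSTS n S) {t : ℕ} {Z VH : Finset (Fin n)}
    (h : IsAbsorbingStructure S t Z VH) :
    Z ⊆ VH ∧ Z.card = 2 * t ∧ VH.card ≤ 1090 * t ∧
    ∀ Z' ⊆ Z, Z'.card = t → ∃ M, PMon S (VH \ Z') M := by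
  obtain ⟨VT, E, ext, hVT, hE, hE3, hZ, hZc, hres, habs, hdis, rfl⟩ := h
  have hA : ∀ e, ∃ M, e ∈ E → PMon S (e ∪ ext e) M := by
    intro e
    by_cases he : e ∈ E
    · obtain ⟨x, y, z, hxyz, ha, -⟩ := habs e he
      obtain ⟨⟨M, hM⟩, -⟩ := absorber_matchings hS ha
      exact ⟨M, fun _ => by rw [← hxyz] at hM; exact hM⟩
    · exact ⟨∅, fun h => absurd h he⟩
  have hB : ∀ e, ∃ M, e ∈ E → PMon S (ext e) M := by
    intro e
    by_cases he : e ∈ E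
    · obtain ⟨x, y, z, hxyz, ha, -⟩ := habs e he
      obtain ⟨-, ⟨M, hM⟩, -⟩ := absorber_matchings hS ha
      exact ⟨M, fun _ => hM⟩
    · exact ⟨∅, fun h => absurd h he⟩
  have hC : ∀ e ∈ E, (ext e).card ≤ 9 := by
    intro e he
    obtain ⟨x, y, z, hxyz, ha, -⟩ := habs e he
    exact (absorber_matchings hS ha).2.2
  have hD : ∀ e ∈ E, Disjoint (ext e) VT := by
    intro e he
    obtain ⟨x, y, z, hxyz, -, ha⟩ := habs e he
    exact ha
  choose MA hMA using hA
  choose MB hMB using hB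
  refine ⟨hZ.trans Finset.subset_union_left, hZc, ?_, ?_⟩
  · have h1 := Finset.card_union_le VT (E.biUnion ext)
    have h2 := Finset.card_biUnion_le_card_mul E ext 9 hC
    omega
  · intro Z' hZ' hc
    obtain ⟨M, hME, hMZ, hMd, hMc⟩ := hres Z' hZ' hc
    have key := PMon.biUnion (S := S) E (fun e => if e ∈ M then e ∪ ext e else ext e)
      (fun e => if e ∈ M then MA e else MB e) ?_ ?_
    · refine key.congr ?_
      ext a
      simp only [Finset.mem_biUnion, Finset.mem_sdiff, Finset.mem_union]
      constructor
      · rintro ⟨e, he, ha⟩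
        have hext : a ∈ ext e → (a ∈ VT ∨ ∃ e ∈ E, a ∈ ext e) ∧ a ∉ Z' := by
          intro ha
          exact ⟨Or.inr ⟨e, he, ha⟩, fun h =>
            Finset.disjoint_left.1 (hD e he) ha (hZ (hZ' h))⟩
        split_ifs at ha with heM
        · rcases Finset.mem_union.1 ha with ha | ha
          · exact ⟨Or.inl ((hE3 e he).2 ha), hMZ e heM a ha⟩
          · exact hext ha
        · exact hext ha
      · rintro ⟨ha | ⟨e, he, ha⟩, hZa⟩
        · obtain ⟨e, heM, hae⟩ := hMc a ha hZa
          exact ⟨e, hME heM, by rw [if_pos heM]; exact Finset.mem_union_left _ hae⟩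
        · refine ⟨e, he, ?_⟩
          split_ifs
          · exact Finset.mem_union_right _ ha
          · exact ha
    · intro e he
      split_ifs
      · exact hMA e he
      · exact hMB e he
    · intro e he f hf hef
      have a1 := hdis e he f hf hef
      have a2 := (hD e he).mono_right (hE3 f hf).2
      have a3 := ((hD f hf).mono_right (hE3 e he).2).symm
      split_ifs with c1 c2 c2
      · have a4 := hMd e c1 f c2 hef
        simp only [Finset.disjoint_union_left, Finset.disjoint_union_right]
        tauto
      · simp only [Finset.disjoint_union_left]; tauto
      · simp only [Finset.disjoint_union_right]; tauto
      · exact a1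

/-- The finishing step: leftover good vertices together with the absorbing structure. -/
theorem finish {n : ℕ} {S : Finset (Finset (Fin n))} (hS : IsSTS n S) {m : ℕ}
    {Z VH : Finset (Fin n)} (h : IsAbsorbingStructure S (3 * m) Z VH)
    (hW : ∀ W : Finset (Fin n), 3 * m ≤ W.card → ∃ e ∈ S, e ⊆ W)
    (R : Finset (Fin n)) (r : ℕ) (hR : R.card = 3 * r) (hrm : 2 * r ≤ m) (hd : Disjoint R VH)
    (hdeg : ∀ v ∈ R, 2 * R.card < pairDeg S Z v + 2) :
    ∃ M, PMon S (R ∪ VH) M := by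
  obtain ⟨hZ, hZc, -, hres⟩ := absorbing hS h
  obtain ⟨Z₁, M₁, hZ₁, hZ₁c, hM₁⟩ := match_into hS Z R (hd.mono_right hZ) hdeg
  have h1 := Finset.card_sdiff_of_subset hZ₁
  obtain ⟨A, M₂, hM₂, hA, hM₂c⟩ := greedy_edges hS (3 * m) (Z \ Z₁) (m - 2 * r) (by omega) hW
  have h2 := hM₂.card hS
  have hdA : Disjoint Z₁ A := Finset.disjoint_sdiff.mono_right hA
  have hAZ : A ⊆ Z := hA.trans Finset.sdiff_subset
  have h3 : (Z₁ ∪ A).card = 3 * m := by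
    rw [Finset.card_union_of_disjoint hdA]; omega
  have h4 : Z₁ ∪ A ⊆ Z := Finset.union_subset hZ₁ hAZ
  obtain ⟨M₃, hM₃⟩ := hres _ h4 h3
  have h5 := hM₁.union hM₂ (by
    rw [Finset.disjoint_union_left]
    exact ⟨hd.mono_right (hAZ.trans hZ), hdA⟩)
  have h6 := h5.union hM₃ (by
    rw [Finset.union_assoc, Finset.disjoint_union_left]
    exact ⟨hd.mono_right Finset.sdiff_subset, Finset.disjoint_sdiff⟩)
  refine h6.congr ?_
  rw [Finset.union_assoc, Finset.union_assoc, ← Finset.union_assoc Z₁,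
    Finset.union_sdiff_of_subset (h4.trans hZ)]

/-- Matchings of size `i` inside `W`. -/
def mats {n : ℕ} (S : Finset (Finset (Fin n))) (W : Finset (Fin n)) (i : ℕ) :
    Finset (Finset (Finset (Fin n))) :=
  Finset.univ.filter (fun M => IsMatching n S M ∧ M.biUnion id ⊆ W ∧ M.card = i)

theorem mats_step {n : ℕ} {S : Finset (Finset (Fin n))} (hS : IsSTS n S) (W : Finset (Fin n))
    (i : ℕ) (b : ℝ)
    (hb : ∀ X : Finset (Fin n), X.card = W.card - 3 * i →
      b ≤ ((S.filter (fun e => e ⊆ X)).card : ℝ)) :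
    ((mats S W i).card : ℝ) * b ≤ (mats S W (i + 1)).card * (i + 1 : ℝ) := by
  have key : (mats S W i).card * ⌈b⌉₊ ≤ (mats S W (i + 1)).card * (i + 1) := by
    refine Finset.card_mul_le_card_mul (fun M M' => M ⊆ M') ?_ ?_
    · intro M hM
      simp only [mats, Finset.mem_filter, Finset.mem_univ, true_and] at hM
      obtain ⟨hM, hMW, hMc⟩ := hM
      have hP : PMon S (M.biUnion id) M := ⟨hM, rfl⟩
      have hc := hP.card hS
      have hX := hb (W \ M.biUnion id) (by rw [Finset.card_sdiff_of_subset hMW]; omega)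
      refine (Nat.ceil_le.2 hX).trans ?_
      have hnot : ∀ e ∈ S.filter (fun e => e ⊆ W \ M.biUnion id),
          Disjoint (M.biUnion id) e ∧ e ∉ M := by
        intro e he
        obtain ⟨heS, heW⟩ := Finset.mem_filter.1 he
        have hd : Disjoint (M.biUnion id) e := Finset.disjoint_sdiff.mono_right heW
        refine ⟨hd, fun heM => ?_⟩
        have h1 : e = ∅ := Finset.disjoint_self_iff_empty _ |>.1 (hd.mono_left (hP.subset heM))
        have := hS.1 e heS
        simp [h1] at this
      refine Finset.card_le_card_of_injOn (fun e => insert e M) ?_ ?_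
      · intro e he
        rw [Finset.mem_coe] at he
        obtain ⟨hd, heM⟩ := hnot e he
        obtain ⟨heS, heW⟩ := Finset.mem_filter.1 he
        have hu := hP.union (PMon.single heS) hd
        have hins : insert e M = M ∪ {e} := by
          rw [Finset.union_comm]; rfl
        simp only [Finset.coe_bipartiteAbove, Set.mem_ofPred_eq, mats, Finset.mem_filter,
          Finset.mem_univ, true_and]
        rw [Finset.card_insert_of_notMem heM, hins]
        refine ⟨⟨hu.1, ?_, by omega⟩, Finset.subset_union_left⟩
        rw [hu.2]
        exact Finset.union_subset hMW (heW.trans Finset.sdiff_subset)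
      · intro e he f hf hef
        rw [Finset.mem_coe] at he hf
        have h1 : e ∈ insert f M := by
          have : insert e M = insert f M := hef
          rw [← this]; simp
        rcases Finset.mem_insert.1 h1 with h | h
        · exact h
        · exact absurd h (hnot e he).2
    · intro M' hM'
      simp only [mats, Finset.mem_filter, Finset.mem_univ, true_and] at hM'
      have : Finset.bipartiteBelow (fun M M' => M ⊆ M') (mats S W i) M' ⊆
          M'.powersetCard i := by
        intro M hM
        simp only [Finset.mem_bipartiteBelow, mats, Finset.mem_filter, Finset.mem_univ,
          true_and] at hM
        exact Finset.mem_powersetCard.2 ⟨hM.2, hM.1.2.2⟩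
      refine (Finset.card_le_card this).trans ?_
      rw [Finset.card_powersetCard, hM'.2.2]
      simp
  have h2 : (b : ℝ) ≤ ⌈b⌉₊ := Nat.le_ceil b
  calc ((mats S W i).card : ℝ) * b ≤ (mats S W i).card * (⌈b⌉₊ : ℝ) := by gcongr
    _ ≤ _ := by exact_mod_cast key

theorem mats_count {n : ℕ} {S : Finset (Finset (Fin n))} (hS : IsSTS n S) (W : Finset (Fin n))
    (u : ℕ) (hu : W.card = 3 * u) (q : ℝ) (hq : 0 ≤ q) (N : ℕ) (hN : N ≤ u)
    (hb : ∀ i < N, ∀ X : Finset (Fin n), X.card = 3 * (u - i) →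
      q * ((u - i : ℕ) : ℝ) ^ 3 ≤ ((S.filter (fun e => e ⊆ X)).card : ℝ)) :
    q ^ N * (u.descFactorial N : ℝ) ^ 3 ≤ (mats S W N).card * (N.factorial : ℝ) := by
  induction N with
  | zero =>
    have : (∅ : Finset (Finset (Fin n))) ∈ mats S W 0 := by
      simp [mats, IsMatching]
    have h1 : 0 < (mats S W 0).card := Finset.card_pos.2 ⟨_, this⟩
    have h2 : (1 : ℝ) ≤ (mats S W 0).card := by exact_mod_cast h1
    simpa using h2
  | succ N ih =>
    have ih' := ih (by omega) (fun i hi => hb i (by omega))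
    have hs := mats_step hS W N (q * ((u - N : ℕ) : ℝ) ^ 3)
      (fun X hX => hb N (by omega) X (by omega))
    rw [Nat.descFactorial_succ, Nat.factorial_succ]
    push_cast
    have h0 : 0 ≤ q * ((u - N : ℕ) : ℝ) ^ 3 := by positivity
    calc q ^ (N + 1) * (((u - N : ℕ) : ℝ) * (u.descFactorial N : ℝ)) ^ 3
        = (q ^ N * (u.descFactorial N : ℝ) ^ 3) * (q * ((u - N : ℕ) : ℝ) ^ 3) := by ring
      _ ≤ ((mats S W N).card * (N.factorial : ℝ)) * (q * ((u - N : ℕ) : ℝ) ^ 3) := by gcongr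
      _ = ((mats S W N).card * (q * ((u - N : ℕ) : ℝ) ^ 3)) * (N.factorial : ℝ) := by ring
      _ ≤ ((mats S W (N + 1)).card * (N + 1 : ℝ)) * (N.factorial : ℝ) := by gcongr
      _ = _ := by ring

theorem mats_le_numPM {n : ℕ} {S : Finset (Finset (Fin n))} (W : Finset (Fin n)) (N : ℕ)
    (h : ∀ M ∈ mats S W N, ∃ P, IsMatching n S P ∧ P.card = n / 3 ∧ M ⊆ P) :
    (mats S W N).card ≤ numPM n S * (n / 3).choose N := by
  have := Finset.card_mul_le_card_mul (fun M P : Finset (Finset (Fin n)) => M ⊆ P)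
    (s := mats S W N) (t := Finset.univ.filter (fun M : Finset (Finset (Fin n)) =>
    IsMatching n S M ∧ M.card = n / 3)) (m := 1) (n := (n / 3).choose N) ?_ ?_
  · simpa [numPM] using this
  · intro M hM
    obtain ⟨P, h1, h2, h3⟩ := h M hM
    refine Finset.card_pos.2 ⟨P, ?_⟩
    simp [Finset.mem_bipartiteAbove, h1, h2, h3]
  · intro P hP
    simp only [Finset.mem_filter, Finset.mem_univ, true_and] at hP
    have : Finset.bipartiteBelow (fun M P => M ⊆ P) (mats S W N) P ⊆ P.powersetCard N := by
      intro M hM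
      simp only [Finset.mem_bipartiteBelow, mats, Finset.mem_filter, Finset.mem_univ,
        true_and] at hM
      exact Finset.mem_powersetCard.2 ⟨hM.2, hM.1.2.2⟩
    refine (Finset.card_le_card this).trans ?_
    rw [Finset.card_powersetCard, hP.2]

theorem fact_bound (k u N : ℕ) (hN : N ≤ u) (hu : u ≤ k) :
    k.factorial ≤ k ^ (k - N) * u.descFactorial N := by
  have h1 := Nat.factorial_mul_descFactorial hN
  have h2 := Nat.factorial_mul_descFactorial (show k - u ≤ k by omega)
  have h3 : k - (k - u) = u := by omega
  rw [h3] at h2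
  have h4 := Nat.descFactorial_le_pow k (k - u)
  have h5 : (u - N).factorial ≤ k ^ (u - N) :=
    (Nat.factorial_le_pow (u - N)).trans (Nat.pow_le_pow_left (by omega) _)
  have h6 : k - N = (k - u) + (u - N) := by omega
  rw [← h2, ← h1, h6, pow_add]
  calc (u - N).factorial * u.descFactorial N * k.descFactorial (k - u)
      ≤ k ^ (u - N) * u.descFactorial N * k ^ (k - u) := by gcongr
    _ = _ := by ring

theorem count_bound (k u N A P : ℕ) (q : ℝ) (hq : 0 < q) (hq1 : q ≤ 1) (hN : N ≤ u) (hu : u ≤ k)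
    (h1 : q ^ N * (u.descFactorial N : ℝ) ^ 3 ≤ (A : ℝ) * (N.factorial : ℝ))
    (h2 : A ≤ P * k.choose N) :
    q ^ k * (k.factorial : ℝ) ^ 2 ≤ P * (k : ℝ) ^ (3 * (k - N)) := by
  have h3 : (A : ℝ) * N.factorial ≤ P * k.factorial := by
    have : A * N.factorial ≤ P * k.factorial := by
      calc A * N.factorial ≤ P * k.choose N * N.factorial := by gcongr
        _ = P * (N.factorial * k.choose N) := by ring
        _ = P * k.descFactorial N := by rw [Nat.descFactorial_eq_factorial_mul_choose]
        _ ≤ P * k.factorial := by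
          gcongr
          rw [← Nat.factorial_mul_descFactorial (hN.trans hu)]
          exact Nat.le_mul_of_pos_left _ (Nat.factorial_pos _)
    exact_mod_cast this
  have h4 : (k.factorial : ℝ) ≤ (k : ℝ) ^ (k - N) * u.descFactorial N := by
    exact_mod_cast fact_bound k u N hN hu
  have h5 : q ^ k ≤ q ^ N := pow_le_pow_of_le_one hq.le hq1 (hN.trans hu)
  have hk : (0 : ℝ) < k.factorial := by exact_mod_cast Nat.factorial_pos k
  have h6 : (q ^ k * (k.factorial : ℝ) ^ 2) * k.factorial
      ≤ (P * (k : ℝ) ^ (3 * (k - N))) * k.factorial := by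
    calc (q ^ k * (k.factorial : ℝ) ^ 2) * k.factorial = q ^ k * (k.factorial : ℝ) ^ 3 := by ring
      _ ≤ q ^ N * ((k : ℝ) ^ (k - N) * u.descFactorial N) ^ 3 := by gcongr
      _ = (q ^ N * (u.descFactorial N : ℝ) ^ 3) * (k : ℝ) ^ (3 * (k - N)) := by
        rw [mul_pow, ← pow_mul, mul_comm (k - N) 3]; ring
      _ ≤ (P * k.factorial) * (k : ℝ) ^ (3 * (k - N)) :=
        mul_le_mul_of_nonneg_right (h1.trans h3) (by positivity)
      _ = _ := by ring
  exact le_of_mul_le_mul_right h6 hk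

theorem final_bound (β γ : ℝ) (hβ : 0 < β) (hβ1 : β < 1) (hγ : 0 < γ) (k P s : ℕ) (hk : 2 ≤ k)
    (hpos : 0 ≤ 1 - β - γ)
    (hs : 3 * (s : ℝ) * Real.log k ≤ γ * k)
    (h : ((1 - β) * 3 / (2 * k)) ^ k * (k.factorial : ℝ) ^ 2 ≤ P * (k : ℝ) ^ (3 * s)) :
    ((1 - β - γ) * (3 * k) / (2 * Real.exp 1 ^ 2)) ^ k ≤ (P : ℝ) := by
  have hk0 : (0 : ℝ) < k := by exact_mod_cast (by omega : 0 < k)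
  have h1 : (k : ℝ) ^ (3 * s) ≤ Real.exp γ ^ k := by
    rw [← Real.exp_log (pow_pos hk0 (3 * s)), ← Real.exp_nat_mul, Real.exp_le_exp, Real.log_pow]
    push_cast
    linarith
  have h2 : ((k : ℝ) / Real.exp 1) ^ k ≤ k.factorial := by
    have := Real.pow_div_factorial_le_exp (k : ℝ) hk0.le k
    have hf : (0 : ℝ) < k.factorial := by exact_mod_cast Nat.factorial_pos k
    rw [div_le_iff₀ hf] at this
    rw [div_pow, ← Real.exp_nat_mul, mul_one, div_le_iff₀ (Real.exp_pos _)]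
    linarith
  have hq : 0 < (1 - β) * 3 / (2 * k) := by
    have : 0 < 1 - β := by linarith
    positivity
  have h3 : ((1 - β) * (3 * k) / (2 * Real.exp 1 ^ 2)) ^ k ≤ P * Real.exp γ ^ k := by
    calc ((1 - β) * (3 * k) / (2 * Real.exp 1 ^ 2)) ^ k
        = ((1 - β) * 3 / (2 * k)) ^ k * (((k : ℝ) / Real.exp 1) ^ k) ^ 2 := by
          rw [← pow_mul, mul_comm k 2, pow_mul, ← mul_pow]
          congr 1
          have := Real.exp_pos 1
          field_simp
      _ ≤ ((1 - β) * 3 / (2 * k)) ^ k * (k.factorial : ℝ) ^ 2 := by gcongr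
      _ ≤ P * (k : ℝ) ^ (3 * s) := h
      _ ≤ _ := by gcongr
  have h4 : (1 - β - γ) * Real.exp γ ≤ 1 - β := by
    have e1 : 1 - γ ≤ Real.exp (-γ) := by
      have := Real.add_one_le_exp (-γ); linarith
    have e2 : 1 - β - γ ≤ (1 - β) * Real.exp (-γ) := by
      have : (1 - β) * (1 - γ) ≤ (1 - β) * Real.exp (-γ) :=
        mul_le_mul_of_nonneg_left e1 (by linarith)
      nlinarith
    calc (1 - β - γ) * Real.exp γ ≤ (1 - β) * Real.exp (-γ) * Real.exp γ := by gcongr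
      _ = 1 - β := by rw [mul_assoc, ← Real.exp_add]; simp
  have hE : 0 < Real.exp γ ^ k := pow_pos (Real.exp_pos _) _
  refine le_of_mul_le_mul_right ?_ hE
  refine le_trans ?_ h3
  rw [← mul_pow]
  have hb : (1 - β - γ) * (3 * k) / (2 * Real.exp 1 ^ 2) * Real.exp γ
      = ((1 - β - γ) * Real.exp γ) * (3 * k) / (2 * Real.exp 1 ^ 2) := by ring
  rw [hb]
  gcongr

/-- Perfect matchings via absorbers: a Steiner triple system with an absorbing
structure, few vertices of low degree into the flexible set, and lower-bounded
densities in all large vertex subsets, has many perfect matchings. -/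
theorem perfect_matchings_via_absorbers :
    ∀ β γ : ℝ, 0 < β → β < 1 → 0 < γ →
    ∃ c : ℝ, 0 < c ∧ ∃ n₀ : ℕ, ∀ n : ℕ, n₀ ≤ n → n % 6 = 3 →
    ∀ δ : ℝ, 0 < δ → δ * Real.log n ≤ c →
    ∀ S : Finset (Finset (Fin n)), IsSTS n S →
    ∀ Z VH : Finset (Fin n),
    -- (1) absorbing structure with flexible set of size 6⌊δ²n⌋
    IsAbsorbingStructure S (3 * ⌊δ ^ 2 * (n : ℝ)⌋₊) Z VH →
    -- (2) few vertices outside `VH` with low degree into `Z`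
    (((Finset.univ.filter (fun v : Fin n =>
        v ∉ VH ∧ (pairDeg S Z v : ℝ) < 6 * δ ^ 5 * n)).card : ℝ) ≤ δ * n) →
    -- (3) all large vertex subsets induce many hyperedges
    (∀ W : Finset (Fin n), 3 * δ ^ 5 * n ≤ (W.card : ℝ) →
      (1 - β) * (W.card : ℝ) ^ 3 / (6 * n) ≤ ((S.filter (fun e => e ⊆ W)).card : ℝ)) →
    ((1 - β - γ) * n / (2 * Real.exp 1 ^ 2)) ^ (n / 3) ≤ (numPM n S : ℝ) := by
  intro β γ hβ hβ1 hγ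
  refine ⟨min (γ / 9828) (1 / 10000), by positivity, 9, ?_⟩
  intro n hn hn6 δ hδ hδc S hS Z VH hH hbad hdens
  obtain ⟨k, hk⟩ : ∃ k, n = 3 * k := ⟨n / 3, by omega⟩
  have hk3 : n / 3 = k := by omega
  have hk2 : 3 ≤ k := by omega
  by_cases hpos : 0 ≤ 1 - β - γ
  swap
  · have hodd : Odd (n / 3) := ⟨n / 6, by omega⟩
    refine le_trans (hodd.pow_nonpos ?_) (Nat.cast_nonneg _)
    push Not at hpos
    apply div_nonpos_of_nonpos_of_nonneg
    · exact mul_nonpos_of_nonpos_of_nonneg hpos.le (Nat.cast_nonneg _)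
    · positivity
  have hnR : (9 : ℝ) ≤ n := by exact_mod_cast hn
  have hlog1 : 1 ≤ Real.log n := by
    rw [Real.le_log_iff_exp_le (by linarith)]
    have := Real.exp_one_lt_d9
    linarith
  have hδ1 : δ * Real.log n ≤ γ / 9828 := hδc.trans (min_le_left _ _)
  have hδ2 : δ ≤ 1 / 10000 := by
    have : δ * Real.log n ≤ 1 / 10000 := hδc.trans (min_le_right _ _)
    nlinarith
  obtain ⟨hZVH, hZc, hVHc, hres⟩ := absorbing hS hH
  have hD2 : δ ^ 2 ≤ δ / 10000 := by nlinarith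
  have hD3 : δ ^ 3 ≤ 1 / 10000 := by
    calc δ ^ 3 = δ ^ 2 * δ := by ring
      _ ≤ (δ / 10000) * 1 := by gcongr; linarith
      _ ≤ _ := by linarith
  have hD5 : δ ^ 5 ≤ δ ^ 2 / 10000 := by
    calc δ ^ 5 = δ ^ 2 * δ ^ 3 := by ring
      _ ≤ δ ^ 2 * (1 / 10000) := by gcongr
      _ = _ := by ring
  have hδ5pos : 0 < δ ^ 5 * n := by positivity
  set m := ⌊δ ^ 2 * (n : ℝ)⌋₊ with hm
  set r := ⌊δ ^ 5 * (n : ℝ)⌋₊ with hr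
  have hmle : (m : ℝ) ≤ δ ^ 2 * n := Nat.floor_le (by positivity)
  have hmlt : δ ^ 2 * n < m + 1 := Nat.lt_floor_add_one _
  have hrle : (r : ℝ) ≤ δ ^ 5 * n := Nat.floor_le (by positivity)
  have hrlt : δ ^ 5 * n < r + 1 := Nat.lt_floor_add_one _
  have hD2n : δ ^ 2 * n ≤ δ * n / 10000 := by nlinarith
  have hD5n : δ ^ 5 * n ≤ δ ^ 2 * n / 10000 := by nlinarith
  have hD1n : δ * n ≤ n / 10000 := by nlinarith
  set B := Finset.univ.filter (fun v : Fin n =>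
        v ∉ VH ∧ (pairDeg S Z v : ℝ) < 6 * δ ^ 5 * n) with hB
  have hVHR : (VH.card : ℝ) ≤ 1090 * (3 * m) := by exact_mod_cast hVHc
  -- `m` is positive
  have hm1 : 1 ≤ m := by
    by_contra hm0
    have hm0 : m = 0 := by omega
    rw [hm0] at hZc hVHc
    have hZ0 : Z = ∅ := Finset.card_eq_zero.1 (by omega)
    have hV0 : VH = ∅ := Finset.card_eq_zero.1 (by omega)
    have hBu : B = Finset.univ := by
      rw [hB, Finset.filter_eq_self]
      intro v _
      refine ⟨by simp [hV0], ?_⟩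
      have : pairDeg S Z v = 0 := by
        simp [pairDeg, hZ0]
      rw [this]
      push_cast
      linarith
    rw [hBu, Finset.card_univ, Fintype.card_fin] at hbad
    linarith
  have hm1R : (1 : ℝ) ≤ m := by exact_mod_cast hm1
  have hrm : 2 * r ≤ m := by
    have : (2 * r : ℝ) ≤ m := by linarith
    exact_mod_cast this
  have hW : ∀ W : Finset (Fin n), 3 * m ≤ W.card → ∃ e ∈ S, e ⊆ W := by
    intro W hWc
    have hWR : (3 * m : ℝ) ≤ W.card := by exact_mod_cast hWc
    have h1 := hdens W (by linarith)
    have h2 : 0 < (1 - β) * (W.card : ℝ) ^ 3 / (6 * n) := by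
      have : 0 < 1 - β := by linarith
      have : (0 : ℝ) < W.card := by linarith
      positivity
    have h3 : 0 < (S.filter (fun e => e ⊆ W)).card := by exact_mod_cast h2.trans_le h1
    obtain ⟨e, he⟩ := Finset.card_pos.1 h3
    exact ⟨e, (Finset.mem_filter.1 he).1, (Finset.mem_filter.1 he).2⟩
  -- cover bad vertices
  obtain ⟨A, M₀, hM₀, hBA, hAVH, hM₀c⟩ := cover_bad hS VH B
    (by
      rw [Finset.disjoint_left]
      intro v hv
      exact (Finset.mem_filter.1 hv).2.1)
    (by
      have : (3 * (VH.card + 3 * B.card) + 1 : ℝ) < n := by linarith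
      exact_mod_cast this)
  have hAc := hM₀.card hS
  have hM₀R : (M₀.card : ℝ) ≤ δ * n := le_trans (by exact_mod_cast hM₀c) hbad
  -- divisibility
  obtain ⟨vh, hvh⟩ : ∃ vh, VH.card = 3 * vh := by
    obtain ⟨Z', hZ', hZ'c⟩ := Finset.exists_subset_card_eq (show 3 * m ≤ Z.card by omega)
    obtain ⟨M, hM⟩ := hres Z' hZ' hZ'c
    have h1 := hM.card hS
    rw [Finset.card_sdiff_of_subset (hZ'.trans hZVH)] at h1
    have h2 := Finset.card_le_card (hZ'.trans hZVH)
    exact ⟨M.card + m, by omega⟩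
  have hvhR : (3 * vh : ℝ) ≤ 3270 * m := by
    have : (VH.card : ℝ) = 3 * vh := by exact_mod_cast hvh
    linarith
  set W₀ := Finset.univ \ (A ∪ VH) with hW₀
  have hAVc : (A ∪ VH).card = 3 * (M₀.card + vh) := by
    rw [Finset.card_union_of_disjoint hAVH]; omega
  have hkR : (n : ℝ) = 3 * k := by exact_mod_cast hk
  have hsum : M₀.card + vh + r ≤ k := by
    have : (M₀.card + vh + r : ℝ) ≤ k := by linarith
    exact_mod_cast this
  set u := k - (M₀.card + vh) with hu
  have hW₀c : W₀.card = 3 * u := by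
    rw [hW₀, Finset.card_sdiff_of_subset (Finset.subset_univ _), Finset.card_univ,
      Fintype.card_fin, hAVc]
    omega
  set N := u - r with hN
  set q : ℝ := (1 - β) * 3 / (2 * k) with hq
  have hkpos : (3 : ℝ) ≤ k := by exact_mod_cast hk2
  have hq0 : 0 < q := by
    have : 0 < 1 - β := by linarith
    positivity
  have hq1 : q ≤ 1 := by
    rw [hq, div_le_one (by linarith)]
    linarith
  have hcount := mats_count hS W₀ u hW₀c q hq0.le N (by omega) (by
    intro i hi X hX
    have hXR : (X.card : ℝ) = 3 * ((u - i : ℕ) : ℝ) := by exact_mod_cast hX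
    have hui : r + 1 ≤ u - i := by omega
    have huiR : (r + 1 : ℝ) ≤ ((u - i : ℕ) : ℝ) := by exact_mod_cast hui
    have h1 := hdens X (by rw [hXR]; linarith)
    refine le_trans (le_of_eq ?_) h1
    rw [hXR, hkR, hq]
    field_simp
    ring)
  have hle := mats_le_numPM (S := S) W₀ N (by
    intro M hM
    simp only [mats, Finset.mem_filter, Finset.mem_univ, true_and] at hM
    obtain ⟨hM, hMW, hMc⟩ := hM
    have hP : PMon S (M.biUnion id) M := ⟨hM, rfl⟩
    have hc := hP.card hS
    have hWd : Disjoint W₀ (A ∪ VH) := Finset.sdiff_disjoint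
    have hRc : (W₀ \ M.biUnion id).card = 3 * r := by
      rw [Finset.card_sdiff_of_subset hMW]; omega
    have hRd : Disjoint (W₀ \ M.biUnion id) (A ∪ VH) := hWd.mono_left Finset.sdiff_subset
    rw [Finset.disjoint_union_right] at hRd
    obtain ⟨M₂, hM₂⟩ := finish hS hH hW (W₀ \ M.biUnion id) r hRc hrm hRd.2 (by
      intro v hv
      have hvB : v ∉ B := fun h => Finset.disjoint_left.1 hRd.1 hv (hBA h)
      have hvV : v ∉ VH := Finset.disjoint_left.1 hRd.2 hv
      have h1 : 6 * δ ^ 5 * n ≤ (pairDeg S Z v : ℝ) := by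
        by_contra h
        push Not at h
        exact hvB (Finset.mem_filter.2 ⟨Finset.mem_univ _, hvV, h⟩)
      rw [hRc]
      have : (2 * (3 * r) : ℝ) < pairDeg S Z v + 2 := by linarith
      exact_mod_cast this)
    have h1 := hP.union hM₂ (by
      rw [Finset.disjoint_union_right]
      exact ⟨Finset.disjoint_sdiff,
        (Finset.disjoint_union_right.1 (hWd.mono_left hMW)).2⟩)
    have h2 := h1.union hM₀ (by
      rw [← Finset.union_assoc, Finset.union_sdiff_of_subset hMW, Finset.disjoint_union_left]
      exact ⟨(Finset.disjoint_union_right.1 hWd).1, hAVH.symm⟩)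
    refine ⟨_, h2.1, ?_, Finset.subset_union_left.trans Finset.subset_union_left⟩
    have h3 : M.biUnion id ∪ (W₀ \ M.biUnion id ∪ VH) ∪ A = Finset.univ := by
      rw [← Finset.union_assoc, Finset.union_sdiff_of_subset hMW, Finset.union_assoc,
        Finset.union_comm VH A, hW₀]
      exact Finset.sdiff_union_of_subset (Finset.subset_univ _)
    have h4 := h2.card hS
    rw [h3, Finset.card_univ, Fintype.card_fin] at h4
    omega)
  rw [hk3] at hle ⊢
  have hcb := count_bound k u N _ _ q hq0 hq1 (by omega) (by omega) hcount hle
  have hfin := final_bound β γ hβ hβ1 hγ k _ (k - N) (by omega) hpos ?_ hcb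
  · rw [hkR]; exact hfin
  · have hs : k - N = M₀.card + vh + r := by omega
    have hsR : ((k - N : ℕ) : ℝ) ≤ 1092 * (δ * n) := by
      rw [hs]; push_cast; linarith
    have hlk : Real.log k ≤ Real.log n := Real.log_le_log (by linarith) (by linarith)
    have hlk0 : 0 ≤ Real.log k := Real.log_nonneg (by linarith)
    calc 3 * ((k - N : ℕ) : ℝ) * Real.log k ≤ 3 * (1092 * (δ * n)) * Real.log n := by gcongr
      _ = 3276 * n * (δ * Real.log n) := by ring
      _ ≤ 3276 * n * (γ / 9828) := by gcongr
      _ = γ * k := by rw [hkR]; ring
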